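/- Let G be a vertex-weighted graph, let u and u' be two distinct vertices of G, and let A be the vertex set of a connected component of G−{u,u'}; assume α(G[A ∖ N[u]]) ≥ α(G[A ∖ N[u']]). Let G' be the graph obtained from G by removing A, adding three new vertices v₁, v₂, v₃ with weights w(v₁)=α(G[A∖N[u']])−α(G[A∖N[{u,u'}]]), w(v₂)=α(G[A∖N[u]])−α(G[A∖N[{u,u'}]]), and w(v₃)=α(G[A])−α(G[A∖N[u]]), and adding the five edges uv₁, v₁v₂, v₂u', uv₃ and u'v₃. Then α(G) = α(G') + α(G[A ∖ N[{u,u'}]]). -/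

import Mathlib

open scoped Classical

namespace MWIS

variable {V : Type*}

/-- A finset of vertices is an independent set of `G`. -/
def IsIndepSet (G : SimpleGraph V) (s : Finset V) : Prop :=
  ∀ ⦃a⦄, a ∈ s → ∀ ⦃b⦄, b ∈ s → ¬G.Adj a b

/-- The maximum total weight of an independent set of `G` contained in `A`
(i.e. α of the induced subgraph `G[A]`, with the inherited weights). -/
noncomputable def alphaOn [Fintype V] (G : SimpleGraph V) (w : V → ℝ) (A : Finset V) : ℝ :=
  sSup {x : ℝ | ∃ s : Finset V, s ⊆ A ∧ IsIndepSet G s ∧ x = ∑ v ∈ s, w v}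

/-- The maximum total weight of an independent set of `G`. -/
noncomputable def alpha [Fintype V] (G : SimpleGraph V) (w : V → ℝ) : ℝ :=
  alphaOn G w Finset.univ

/-- The open neighborhood of a vertex, as a finset. -/
noncomputable def nbrs [Fintype V] (G : SimpleGraph V) (v : V) : Finset V :=
  Finset.univ.filter fun u => G.Adj v u

/-- The degree of a vertex. -/
noncomputable def deg [Fintype V] (G : SimpleGraph V) (v : V) : ℕ :=
  (nbrs G v).card

/-- The closed neighborhood `N[v]` of a vertex. -/
noncomputable def closedNbrs [Fintype V] [DecidableEq V] (G : SimpleGraph V) (v : V) : Finset V :=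
  insert v (nbrs G v)

/-- The open neighborhood `N(A)` of a vertex set. -/
noncomputable def openNbhd [Fintype V] [DecidableEq V] (G : SimpleGraph V) (A : Finset V) :
    Finset V :=
  (A.biUnion fun v => nbrs G v) \ A

/-- The closed neighborhood `N[A]` of a vertex set. -/
noncomputable def closedNbhd [Fintype V] [DecidableEq V] (G : SimpleGraph V) (A : Finset V) :
    Finset V :=
  A ∪ A.biUnion fun v => nbrs G v

/-- `s` is a maximum weighted independent set of `G` with weights `w`. -/
def IsMWIS [Fintype V] (G : SimpleGraph V) (w : V → ℝ) (s : Finset V) : Prop :=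
  IsIndepSet G s ∧ ∀ t : Finset V, IsIndepSet G t → ∑ v ∈ t, w v ≤ ∑ v ∈ s, w v

/-- `A` is the vertex set of a connected component of the subgraph of `G` induced on `B`:
`A` is the set of vertices reachable from some `x ∈ B` by paths staying inside `B`. -/
def IsCompOf (G : SimpleGraph V) (B A : Finset V) : Prop :=
  ∃ x ∈ B, ∀ y, y ∈ A ↔ Relation.ReflTransGen (fun a b => a ∈ B ∧ b ∈ B ∧ G.Adj a b) x y

/-- The graph obtained from `G` by attaching three vertices to `u` and `u'`
via the edges `uv₁, v₁v₂, v₂u', uv₃, u'v₃`. -/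
def gadget (G : SimpleGraph V) (u u' : V) : SimpleGraph (V ⊕ Fin 3) :=
  SimpleGraph.fromRel fun a b : V ⊕ Fin 3 =>
    (∃ x y : V, a = Sum.inl x ∧ b = Sum.inl y ∧ G.Adj x y) ∨
    (a = Sum.inl u ∧ b = Sum.inr 0) ∨
    (a = Sum.inr 0 ∧ b = Sum.inr 1) ∨
    (a = Sum.inr 1 ∧ b = Sum.inl u') ∨
    (a = Sum.inl u ∧ b = Sum.inr 2) ∨
    (a = Sum.inl u' ∧ b = Sum.inr 2)

lemma isIndepSet_gadget_disjSum (G : SimpleGraph V) (u u' : V) (T : Finset V)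
    (J : Finset (Fin 3)) :
    IsIndepSet (gadget G u u') (T.disjSum J) ↔
      IsIndepSet G T ∧ (u ∈ T → 0 ∉ J ∧ 2 ∉ J) ∧ (u' ∈ T → 1 ∉ J ∧ 2 ∉ J) ∧
        (0 ∈ J → 1 ∉ J) := by
  constructor
  · intro h
    refine ⟨fun a ha b hb hab => ?_, fun hu => ⟨fun hj => ?_, fun hj => ?_⟩,
      fun hu => ⟨fun hj => ?_, fun hj => ?_⟩, fun h0 h1 => ?_⟩
    · exact h (Finset.inl_mem_disjSum.2 ha) (Finset.inl_mem_disjSum.2 hb)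
        (by simp [gadget, hab, hab.ne])
    · exact h (Finset.inl_mem_disjSum.2 hu) (Finset.inr_mem_disjSum.2 hj) (by simp [gadget])
    · exact h (Finset.inl_mem_disjSum.2 hu) (Finset.inr_mem_disjSum.2 hj) (by simp [gadget])
    · exact h (Finset.inl_mem_disjSum.2 hu) (Finset.inr_mem_disjSum.2 hj) (by simp [gadget])
    · exact h (Finset.inl_mem_disjSum.2 hu) (Finset.inr_mem_disjSum.2 hj) (by simp [gadget])
    · exact h (Finset.inr_mem_disjSum.2 h0) (Finset.inr_mem_disjSum.2 h1) (by simp [gadget])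
  · rintro ⟨hT, hu, hu', h01⟩ a ha b hb hab
    rw [gadget, SimpleGraph.fromRel_adj] at hab
    have key : ∀ a ∈ T.disjSum J, ∀ b ∈ T.disjSum J,
        ¬ ((∃ x y : V, a = Sum.inl x ∧ b = Sum.inl y ∧ G.Adj x y) ∨
          (a = Sum.inl u ∧ b = Sum.inr 0) ∨
          (a = Sum.inr 0 ∧ b = Sum.inr 1) ∨
          (a = Sum.inr 1 ∧ b = Sum.inl u') ∨
          (a = Sum.inl u ∧ b = Sum.inr 2) ∨
          (a = Sum.inl u' ∧ b = Sum.inr 2)) := by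
      rintro a ha b hb (⟨x, y, rfl, rfl, hxy⟩ | ⟨rfl, rfl⟩ | ⟨rfl, rfl⟩ | ⟨rfl, rfl⟩ |
        ⟨rfl, rfl⟩ | ⟨rfl, rfl⟩) <;>
      simp only [Finset.inl_mem_disjSum, Finset.inr_mem_disjSum] at ha hb
      · exact hT ha hb hxy
      · exact (hu ha).1 hb
      · exact h01 ha hb
      · exact (hu' hb).1 ha
      · exact (hu ha).2 hb
      · exact (hu' ha).2 hb
    exact hab.2.elim (key a ha b hb) (key b hb a ha)

lemma finite_weights [Fintype V] (G : SimpleGraph V) (w : V → ℝ) (A : Finset V) :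
    {x : ℝ | ∃ s : Finset V, s ⊆ A ∧ IsIndepSet G s ∧ x = ∑ v ∈ s, w v}.Finite := by
  refine (Set.finite_range fun s : Finset V => ∑ v ∈ s, w v).subset ?_
  rintro _ ⟨s, -, -, rfl⟩
  exact ⟨s, rfl⟩

lemma sum_le_alphaOn [Fintype V] {G : SimpleGraph V} (w : V → ℝ) {A s : Finset V}
    (hs : s ⊆ A) (hi : IsIndepSet G s) : ∑ v ∈ s, w v ≤ alphaOn G w A :=
  le_csSup (finite_weights G w A).bddAbove ⟨s, hs, hi, rfl⟩

lemma exists_sum_eq_alphaOn [Fintype V] (G : SimpleGraph V) (w : V → ℝ) (A : Finset V) :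
    ∃ s ⊆ A, IsIndepSet G s ∧ ∑ v ∈ s, w v = alphaOn G w A := by
  have hne : {x : ℝ | ∃ s : Finset V, s ⊆ A ∧ IsIndepSet G s ∧ x = ∑ v ∈ s, w v}.Nonempty :=
    ⟨0, ∅, by simp, by simp [IsIndepSet], by simp⟩
  obtain ⟨s, hs, hi, h⟩ := hne.csSup_mem (finite_weights G w A)
  exact ⟨s, hs, hi, h.symm⟩

lemma alphaOn_mono [Fintype V] (G : SimpleGraph V) (w : V → ℝ) {A B : Finset V} (h : A ⊆ B) :
    alphaOn G w A ≤ alphaOn G w B := by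
  obtain ⟨s, hs, hi, hsum⟩ := exists_sum_eq_alphaOn G w A
  exact hsum ▸ sum_le_alphaOn w (hs.trans h) hi

lemma IsIndepSet.mono {G : SimpleGraph V} {s t : Finset V} (ht : IsIndepSet G t) (h : s ⊆ t) :
    IsIndepSet G s :=
  fun _ ha _ hb => ht (h ha) (h hb)

lemma IsIndepSet.union [DecidableEq V] {G : SimpleGraph V} {s t : Finset V}
    (hs : IsIndepSet G s) (ht : IsIndepSet G t) (h : ∀ a ∈ s, ∀ b ∈ t, ¬ G.Adj a b) :
    IsIndepSet G (s ∪ t) := by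
  intro a ha b hb hab
  rcases Finset.mem_union.1 ha with ha | ha <;> rcases Finset.mem_union.1 hb with hb | hb
  · exact hs ha hb hab
  · exact h a ha b hb hab
  · exact h b hb a ha hab.symm
  · exact ht ha hb hab

lemma IsCompOf.subset {G : SimpleGraph V} {B A : Finset V} (h : IsCompOf G B A) : A ⊆ B := by
  obtain ⟨x, hx, h⟩ := h
  intro y hy
  rcases ((h y).1 hy).cases_tail with rfl | ⟨_, _, h'⟩
  exacts [hx, h'.2.1]

lemma IsCompOf.mem_of_adj {G : SimpleGraph V} {B A : Finset V} (h : IsCompOf G B A) {a b : V}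
    (ha : a ∈ A) (hb : b ∈ B) (hab : G.Adj a b) : b ∈ A := by
  have haB := h.subset ha
  obtain ⟨x, -, h⟩ := h
  exact (h b).2 (((h a).1 ha).tail ⟨haB, hb, hab⟩)

lemma mem_closedNbrs [Fintype V] [DecidableEq V] {G : SimpleGraph V} {v x : V} :
    x ∈ closedNbrs G v ↔ x = v ∨ G.Adj v x := by
  simp [closedNbrs, nbrs]

/-- An independent set decomposes as a part outside the component `A` and a part inside `A` which
avoids the neighborhoods of those cut vertices that are selected. -/
lemma isIndepSet_union_iff_of_isCompOf [Fintype V] [DecidableEq V] {G : SimpleGraph V} {u u' : V}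
    {A T R : Finset V} (hA : IsCompOf G (Finset.univ \ {u, u'}) A) (hT : Disjoint T A)
    (hR : R ⊆ A) :
    IsIndepSet G (T ∪ R) ↔ IsIndepSet G T ∧ IsIndepSet G R ∧
      (u ∈ T → Disjoint R (closedNbrs G u)) ∧ (u' ∈ T → Disjoint R (closedNbrs G u')) := by
  have cut : ∀ v ∈ T, IsIndepSet G (T ∪ R) → Disjoint R (closedNbrs G v) := by
    intro v hv h
    refine Finset.disjoint_left.2 fun r hr hrv => ?_
    rcases mem_closedNbrs.1 hrv with rfl | hadj
    · exact Finset.disjoint_left.1 hT hv (hR hr)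
    · exact h (Finset.mem_union_left _ hv) (Finset.mem_union_right _ hr) hadj
  refine ⟨fun h => ⟨h.mono Finset.subset_union_left, h.mono Finset.subset_union_right,
    fun hu => cut u hu h, fun hu => cut u' hu h⟩, ?_⟩
  rintro ⟨hTi, hRi, hu, hu'⟩
  refine hTi.union hRi fun t ht r hr hadj => ?_
  by_cases htu : t = u
  · subst htu
    exact Finset.disjoint_left.1 (hu ht) hr (mem_closedNbrs.2 (Or.inr hadj))
  by_cases htu' : t = u'
  · subst htu'
    exact Finset.disjoint_left.1 (hu' ht) hr (mem_closedNbrs.2 (Or.inr hadj))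
  exact Finset.disjoint_left.1 hT ht
    (hA.mem_of_adj (hR hr) (by simp [htu, htu']) hadj.symm)

/-- reduction for a vertex cut `{u, u'}` of size two. `A` is the vertex
set of a connected component of `G − {u, u'}` with `α(G[A∖N[u]]) ≥ α(G[A∖N[u']])`.
The graph `G'` is obtained from `G` by removing `A` and adding three new vertices
`v₁, v₂, v₃` (modelled as `Sum.inr 0`, `Sum.inr 1`, `Sum.inr 2` in `V ⊕ Fin 3`) with
weights `α(G[A∖N[u']]) − α(G[A∖N[{u,u'}]])`, `α(G[A∖N[u]]) − α(G[A∖N[{u,u'}]])` and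
`α(G[A]) − α(G[A∖N[u]])`, together with the five edges `uv₁, v₁v₂, v₂u', uv₃, u'v₃`.
Then `α(G) = α(G') + α(G[A ∖ N[{u,u'}]])`. -/
theorem stmt15 [Fintype V] [DecidableEq V] (G : SimpleGraph V) (w : V → ℝ)
    (hw : ∀ x, 0 < w x) (u u' : V) (hne : u ≠ u') (A : Finset V)
    (hA : IsCompOf G (Finset.univ \ {u, u'}) A)
    (hge : alphaOn G w (A \ closedNbrs G u') ≤ alphaOn G w (A \ closedNbrs G u)) :
    alpha G w =
      alphaOn
        (SimpleGraph.fromRel fun a b : V ⊕ Fin 3 =>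
          (∃ x y : V, a = Sum.inl x ∧ b = Sum.inl y ∧ G.Adj x y) ∨
          (a = Sum.inl u ∧ b = Sum.inr 0) ∨
          (a = Sum.inr 0 ∧ b = Sum.inr 1) ∨
          (a = Sum.inr 1 ∧ b = Sum.inl u') ∨
          (a = Sum.inl u ∧ b = Sum.inr 2) ∨
          (a = Sum.inl u' ∧ b = Sum.inr 2))
        (Sum.elim w fun i =>
          if i = 0 then
            alphaOn G w (A \ closedNbrs G u') -
              alphaOn G w (A \ (closedNbrs G u ∪ closedNbrs G u'))
          else if i = 1 then
            alphaOn G w (A \ closedNbrs G u) -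
              alphaOn G w (A \ (closedNbrs G u ∪ closedNbrs G u'))
          else alphaOn G w A - alphaOn G w (A \ closedNbrs G u))
        (Finset.univ \ A.image Sum.inl)
      + alphaOn G w (A \ (closedNbrs G u ∪ closedNbrs G u')) := by
  change _ = alphaOn (gadget G u u') _ _ + _
  set b := alphaOn G w (A \ (closedNbrs G u ∪ closedNbrs G u')) with hb
  set c := alphaOn G w (A \ closedNbrs G u) with hc
  set c' := alphaOn G w (A \ closedNbrs G u') with hc'
  set W : Fin 3 → ℝ := fun i => if i = 0 then c' - b else if i = 1 then c - b
    else alphaOn G w A - c with hW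
  have hbc' : b ≤ c' :=
    alphaOn_mono G w (Finset.sdiff_subset_sdiff subset_rfl Finset.subset_union_right)
  have hca : c ≤ alphaOn G w A := alphaOn_mono G w Finset.sdiff_subset
  apply le_antisymm
  · obtain ⟨S, -, hS, hsum⟩ := exists_sum_eq_alphaOn G w Finset.univ
    have hsplit : S \ A ∪ S ∩ A = S := Finset.sdiff_union_inter S A
    have hdis : Disjoint (S \ A) A := Finset.sdiff_disjoint
    rw [← hsplit, isIndepSet_union_iff_of_isCompOf hA hdis Finset.inter_subset_right] at hS
    obtain ⟨hTi, hRi, hu, hu'⟩ := hS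
    have hwS : ∑ v ∈ S, w v = ∑ v ∈ S \ A, w v + ∑ v ∈ S ∩ A, w v := by
      rw [← Finset.sum_union (hdis.mono_right Finset.inter_subset_right), hsplit]
    have hJ : ∀ J : Finset (Fin 3), (u ∈ S \ A → 0 ∉ J ∧ 2 ∉ J) →
        (u' ∈ S \ A → 1 ∉ J ∧ 2 ∉ J) → (0 ∈ J → 1 ∉ J) →
        ∑ v ∈ S ∩ A, w v ≤ ∑ i ∈ J, W i + b →
        alpha G w ≤ alphaOn (gadget G u u') (Sum.elim w W)
          (Finset.univ \ A.image Sum.inl) + b := by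
      intro J h1 h2 h3 hle
      have := sum_le_alphaOn (G := gadget G u u') (Sum.elim w W)
        (A := Finset.univ \ A.image Sum.inl) (s := (S \ A).disjSum J)
        (by
          intro x hx
          rcases x with x | x
          · have := Finset.inl_mem_disjSum.1 hx
            simpa using (Finset.mem_sdiff.1 this).2
          · simp)
        ((isIndepSet_gadget_disjSum G u u' _ J).2 ⟨hTi, h1, h2, h3⟩)
      rw [Finset.sum_disjSum] at this
      simp only [Sum.elim_inl, Sum.elim_inr] at this
      rw [alpha, ← hsum, hwS]
      linarith
    by_cases h : u ∈ S \ A <;> by_cases h' : u' ∈ S \ A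
    · refine hJ ∅ (by simp) (by simp) (by simp) ?_
      have := sum_le_alphaOn w (A := A \ (closedNbrs G u ∪ closedNbrs G u'))
        (Finset.subset_sdiff.2 ⟨Finset.inter_subset_right,
          Finset.disjoint_union_right.2 ⟨hu h, hu' h'⟩⟩) hRi
      simpa using this
    · refine hJ {1} (by simp) (by simp [h']) (by simp) ?_
      have := sum_le_alphaOn w
        (Finset.subset_sdiff.2 ⟨Finset.inter_subset_right, hu h⟩) hRi
      simpa [hW] using this
    · refine hJ {0} (by simp [h]) (by simp) (by simp) ?_
      have := sum_le_alphaOn w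
        (Finset.subset_sdiff.2 ⟨Finset.inter_subset_right, hu' h'⟩) hRi
      simpa [hW] using this
    · refine hJ {1, 2} (by simp [h]) (by simp [h']) (by simp) ?_
      have := sum_le_alphaOn w (Finset.inter_subset_right : S ∩ A ⊆ A) hRi
      rw [Finset.sum_pair (by decide)]
      simp only [hW, Fin.reduceEq, one_ne_zero, if_true, if_false]
      linarith
  · obtain ⟨S, hSA, hS, hsum⟩ := exists_sum_eq_alphaOn (gadget G u u') (Sum.elim w W)
      (Finset.univ \ A.image Sum.inl)
    obtain ⟨T, J, rfl⟩ : ∃ T J, S = Finset.disjSum T J :=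
      ⟨S.toLeft, S.toRight, S.toLeft_disjSum_toRight.symm⟩
    obtain ⟨hTi, h1, h2, h3⟩ := (isIndepSet_gadget_disjSum G u u' T J).1 hS
    have hdis : Disjoint T A := Finset.disjoint_left.2 fun x hx hxA => by
      have := hSA (Finset.inl_mem_disjSum.2 hx)
      simp [hxA] at this
    rw [← hsum, Finset.sum_disjSum]
    simp only [Sum.elim_inl, Sum.elim_inr]
    have hB : ∀ B ⊆ A, (u ∈ T → Disjoint B (closedNbrs G u)) →
        (u' ∈ T → Disjoint B (closedNbrs G u')) → ∑ i ∈ J, W i + b ≤ alphaOn G w B →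
        ∑ v ∈ T, w v + ∑ i ∈ J, W i + b ≤ alpha G w := by
      intro B hBA hu hu' hle
      obtain ⟨R, hRB, hRi, hR⟩ := exists_sum_eq_alphaOn G w B
      have hi := (isIndepSet_union_iff_of_isCompOf hA hdis (hRB.trans hBA)).2
        ⟨hTi, hRi, fun h => (hu h).mono_left hRB, fun h => (hu' h).mono_left hRB⟩
      have := sum_le_alphaOn w (Finset.subset_univ _) hi
      rw [Finset.sum_union (hdis.mono_right (hRB.trans hBA)), hR] at this
      rw [alpha]
      linarith
    have hWJ : ∑ i ∈ J, W i = (if 0 ∈ J then c' - b else 0) + (if 1 ∈ J then c - b else 0) +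
        (if 2 ∈ J then alphaOn G w A - c else 0) := by
      rw [← Finset.univ_inter J, ← Finset.sum_ite_mem, Fin.sum_univ_three]
      simp [hW]
    by_cases h : u ∈ T <;> by_cases h' : u' ∈ T
    · refine hB (A \ (closedNbrs G u ∪ closedNbrs G u')) Finset.sdiff_subset
        (fun _ => Finset.sdiff_disjoint.mono_right Finset.subset_union_left)
        (fun _ => Finset.sdiff_disjoint.mono_right Finset.subset_union_right) ?_
      simp [hWJ, h1 h, h2 h', ← hb]
    · refine hB (A \ closedNbrs G u) Finset.sdiff_subset (fun _ => Finset.sdiff_disjoint)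
        (fun hu' => absurd hu' h') ?_
      rw [hWJ, ← hc]
      simp only [h1 h, if_false]
      split_ifs <;> linarith
    · refine hB (A \ closedNbrs G u') Finset.sdiff_subset (fun hu => absurd hu h)
        (fun _ => Finset.sdiff_disjoint) ?_
      rw [hWJ, ← hc']
      simp only [h2 h', if_false]
      split_ifs <;> linarith
    · refine hB A subset_rfl (fun hu => absurd hu h) (fun hu' => absurd hu' h') ?_
      rw [hWJ]
      by_cases h0 : 0 ∈ J
      · simp only [h0, h3 h0, if_true, if_false]
        split_ifs <;> linarith
      · simp only [h0, if_false]
        split_ifs <;> linarith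

end MWIS
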